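/- For squarefree monomials f, g, one always has gcd(f, g) = gcd(f, g²). Consequently, a squarefree minimal monomial sequence is a proper sequence if and only if it is a d-sequence. -/

import Mathlib

open MvPolynomial

/-- d-sequence (0-based): minimal generation plus the colon-ideal condition. -/
def IsDSequence {R : Type*} [CommRing R] {n : ℕ} (f : Fin n → R) : Prop :=
  (∀ i j : Fin n, i ≠ j → ¬f i ∣ f j) ∧
    ∀ i k : Fin n, i ≤ k →
      (Ideal.span (f '' {j | j < i})).colon (Ideal.span {f i * f k}) =
        (Ideal.span (f '' {j | j < i})).colon (Ideal.span {f k})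

/-- Proper sequence (0-based): `f_r` kills the first Koszul homology of the
preceding elements; every Koszul 1-cycle on the first `r` elements times `f_r`
is a combination of the Koszul boundaries. -/
def IsProperSequence {R : Type*} [CommRing R] {n : ℕ} (f : Fin n → R) : Prop :=
  ∀ r : Fin n, ∀ v : Fin n → R,
    (∀ j, r ≤ j → v j = 0) → (∑ j, v j * f j = 0) →
      (fun j => f r * v j) ∈ Submodule.span R
        {w : Fin n → R | ∃ i j : Fin n, i < j ∧ j < r ∧
          w = Pi.single i (f j) - Pi.single j (f i)}

/-- Membership of a multiple of a monomial in an ideal generated by monomials. -/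
theorem mul_monomial_mem_span_iff {K σ ι : Type*} [Field K] (a : ι → σ →₀ ℕ) (S : Set ι)
    (x : MvPolynomial σ K) (b : σ →₀ ℕ) :
    x * monomial b 1 ∈ Ideal.span ((fun i => (monomial (a i) 1 : MvPolynomial σ K)) '' S) ↔
      ∀ c ∈ x.support, ∃ l ∈ S, a l ≤ c + b := by
  have himage : (fun i => (monomial (a i) 1 : MvPolynomial σ K)) '' S =
      (fun s => monomial s 1) '' (a '' S) := by
    rw [Set.image_image]
  rw [himage, mem_ideal_span_monomial_image]
  constructor
  · intro h c hc
    obtain ⟨_, ⟨l, hl, rfl⟩, hle⟩ := h (c + b) (by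
      rw [mem_support_iff, coeff_mul_monomial, mul_one]
      exact mem_support_iff.mp hc)
    exact ⟨l, hl, hle⟩
  · intro h d hd
    rw [mem_support_iff, coeff_mul_monomial'] at hd
    split_ifs at hd with hbd
    · obtain ⟨l, hl, hle⟩ := h (d - b) (by simpa using hd)
      rw [tsub_add_cancel_of_le hbd] at hle
      exact ⟨_, ⟨l, hl, rfl⟩, hle⟩
    · exact absurd rfl hd

theorem monomial_mem_span_iff {K σ ι : Type*} [Field K] (a : ι → σ →₀ ℕ) (S : Set ι)
    (b : σ →₀ ℕ) :
    (monomial b 1 : MvPolynomial σ K) ∈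
        Ideal.span ((fun i => (monomial (a i) 1 : MvPolynomial σ K)) '' S) ↔
      ∃ l ∈ S, a l ≤ b := by
  classical
  have h := mul_monomial_mem_span_iff (K := K) a S 1 b
  rw [one_mul] at h
  rw [h, ← C_1, ← monomial_zero', support_monomial]
  simp

/-- The gcd condition on triples of exponents of a squarefree antichain follows from a
divisibility that both proper sequences and d-sequences provide. -/
theorem inf_le_of_exists_le_add_tsub {σ : Type*} {n : ℕ} (a : Fin n → σ →₀ ℕ)
    (hsq : ∀ i t, a i t ≤ 1) (hmin : ∀ i j, i ≠ j → ¬a i ≤ a j)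
    (h : ∀ i j k, i < j → j < k → ∃ l < k, l ≠ j ∧ a l ≤ a k + (a i - a j)) :
    ∀ k i j, i < j → j < k → a i ⊓ a j ≤ a k := by
  intro k
  induction k using WellFoundedLT.induction with
  | ind k ih =>
    intro i j hij hjk
    obtain ⟨l, hlk, hlj, hl⟩ := h i j k hij hjk
    by_contra hnot
    obtain ⟨t, ht⟩ : ∃ t, ¬min (a i t) (a j t) ≤ a k t := by
      by_contra! hall
      exact hnot fun t => hall t
    have hlt : a l t ≤ a k t + (a i t - a j t) := hl t
    have hit := hsq i t
    have hjt := hsq j t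
    have hlj' : l < j := by
      refine lt_of_le_of_ne (not_lt.mp fun hjl => ?_) hlj
      have : min (a i t) (a j t) ≤ a l t := ih l hlk i j hij hjl t
      omega
    have hil : i ≠ l := by
      rintro rfl
      omega
    have hmeet : a i ⊓ a l ≤ a j := by
      rcases lt_or_gt_of_ne hil with hlt | hgt
      · exact ih j hjk i l hlt hlj'
      · rw [inf_comm]
        exact ih j hjk l i hgt hij
    refine hmin l k hlk.ne fun s => ?_
    have hms : min (a i s) (a l s) ≤ a j s := hmeet s
    have hls : a l s ≤ a k s + (a i s - a j s) := hl s
    have := hsq l s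
    have := hsq i s
    omega

/-- Syzygies of monomials are generated by the pairwise ones. -/
theorem syzygy_mem_span_pairs {K σ : Type*} [Field K] {n : ℕ} (a : Fin n → σ →₀ ℕ) (r : ℕ)
    (v : Fin n → MvPolynomial σ K) (hv : ∀ j : Fin n, r ≤ j → v j = 0)
    (hsum : ∑ j, v j * monomial (a j) 1 = 0) :
    v ∈ Submodule.span (MvPolynomial σ K)
      {w : Fin n → MvPolynomial σ K | ∃ i j : Fin n, i < j ∧ (j : ℕ) < r ∧
        w = Pi.single i (monomial (a j - a i) 1) - Pi.single j (monomial (a i - a j) 1)} := by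
  classical
  induction r generalizing v with
  | zero =>
    rw [show v = 0 from funext fun j => hv j (Nat.zero_le _)]
    exact zero_mem _
  | succ r ih =>
    by_cases hr : r < n
    swap
    · refine Submodule.span_mono ?_ (ih v (fun j hj => absurd j.isLt (by omega)) hsum)
      rintro w ⟨i, j, hij, hj, rfl⟩
      exact ⟨i, j, hij, by omega, rfl⟩
    set q : Fin n := ⟨r, hr⟩
    have hmem : v q * monomial (a q) 1 ∈
        Ideal.span ((fun i => (monomial (a i) 1 : MvPolynomial σ K)) '' {i | i < q}) := by
      rw [← Finset.add_sum_erase _ _ (Finset.mem_univ q)] at hsum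
      rw [eq_neg_of_add_eq_zero_left hsum]
      refine neg_mem (sum_mem fun j hj => ?_)
      rcases lt_or_gt_of_ne (Finset.ne_of_mem_erase hj) with hlt | hgt
      · exact Ideal.mul_mem_left _ _ (Ideal.subset_span ⟨j, hlt, rfl⟩)
      · rw [hv j (Nat.succ_le_of_lt hgt), zero_mul]
        exact zero_mem _
    have hvq : v q ∈ Ideal.span
        ((fun i => (monomial (a i - a q) 1 : MvPolynomial σ K)) '' {i | i < q}) := by
      have h := mul_monomial_mem_span_iff (K := K) (fun i => a i - a q) {i | i < q} (v q) 0
      rw [monomial_zero', C_1, mul_one] at h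
      rw [h]
      intro c hc
      obtain ⟨l, hl, hle⟩ := (mul_monomial_mem_span_iff a _ _ _).mp hmem c hc
      exact ⟨l, hl, by simpa using hle⟩
    -- a combination of pairwise syzygies with the same top coordinate as `v`
    obtain ⟨u, hu, huq, husupp, husum⟩ : ∃ u ∈ Submodule.span (MvPolynomial σ K)
        {w : Fin n → MvPolynomial σ K | ∃ i j : Fin n, i < j ∧ (j : ℕ) < r + 1 ∧
          w = Pi.single i (monomial (a j - a i) 1) - Pi.single j (monomial (a i - a j) 1)},
        u q = v q ∧ (∀ j : Fin n, r + 1 ≤ j → u j = 0) ∧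
          ∑ j, u j * monomial (a j) 1 = 0 := by
      generalize v q = y at hvq ⊢
      refine Submodule.span_induction ?_ ?_ ?_ ?_ hvq
      · rintro _ ⟨l, hl, rfl⟩
        have hlq : l < q := hl
        refine ⟨_, neg_mem (Submodule.subset_span ⟨l, q, hl, Nat.lt_succ_self r, rfl⟩),
          ?_, ?_, ?_⟩
        · simp [hlq.ne']
        · intro j hj
          have hjq : q < j := hj
          simp [hjq.ne', (hlq.trans hjq).ne']
        · have hsup : a q - a l + a l = a l - a q + a q := by
            ext t
            simp only [Finsupp.add_apply, Finsupp.tsub_apply]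
            omega
          simp [sub_mul, Finset.sum_sub_distrib, Pi.single_apply, ite_mul, monomial_mul, hsup]
      · exact ⟨0, zero_mem _, rfl, fun _ _ => rfl, by simp⟩
      · rintro x y _ _ ⟨u, hu, rfl, hu0, hus⟩ ⟨w, hw, rfl, hw0, hws⟩
        refine ⟨u + w, add_mem hu hw, rfl, fun j hj => ?_, ?_⟩
        · simp [hu0 j hj, hw0 j hj]
        · simp [add_mul, Finset.sum_add_distrib, hus, hws]
      · rintro c x _ ⟨u, hu, rfl, hu0, hus⟩
        refine ⟨c • u, Submodule.smul_mem _ c hu, rfl, fun j hj => ?_, ?_⟩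
        · simp [hu0 j hj]
        · simp [mul_assoc, ← Finset.mul_sum, hus]
    have hrest := ih (v - u) (fun j hj => by
      rcases Nat.eq_or_lt_of_le hj with heq | hlt
      · rw [show j = q from Fin.ext heq.symm, Pi.sub_apply, huq, sub_self]
      · rw [Pi.sub_apply, hv j hlt, husupp j hlt, sub_self])
      (by simp [sub_mul, Finset.sum_sub_distrib, hsum, husum])
    rw [← sub_add_cancel v u]
    refine add_mem (Submodule.span_mono ?_ hrest) hu
    rintro w ⟨i, j, hij, hj, rfl⟩
    exact ⟨i, j, hij, by omega, rfl⟩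

theorem isProperSequence_monomial_iff {K σ : Type*} [Field K] {n : ℕ} (a : Fin n → σ →₀ ℕ)
    (hsq : ∀ i t, a i t ≤ 1) (hmin : ∀ i j, i ≠ j → ¬a i ≤ a j) :
    IsProperSequence (fun i => (monomial (a i) 1 : MvPolynomial σ K)) ↔
      ∀ k i j, i < j → j < k → a i ⊓ a j ≤ a k := by
  classical
  constructor
  · intro hprop
    refine inf_le_of_exists_le_add_tsub a hsq hmin fun i j k hij hjk => ?_
    have hspan := hprop k
      (Pi.single i (monomial (a j - a i) 1) - Pi.single j (monomial (a i - a j) 1))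
      (fun l hl => by simp [(hjk.trans_le hl).ne', ((hij.trans hjk).trans_le hl).ne'])
      (by
        have hsup : a j - a i + a i = a i - a j + a j := by
          ext t
          simp only [Finsupp.add_apply, Finsupp.tsub_apply]
          omega
        simp [sub_mul, Finset.sum_sub_distrib, Pi.single_apply, ite_mul, monomial_mul, hsup])
    have hcoord : ∀ w ∈ Submodule.span (MvPolynomial σ K)
        {w : Fin n → MvPolynomial σ K | ∃ p q : Fin n, p < q ∧ q < k ∧
          w = Pi.single p (monomial (a q) 1) - Pi.single q (monomial (a p) 1)},
        w j ∈ Ideal.span ((fun i => (monomial (a i) 1 : MvPolynomial σ K)) ''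
          {l | l < k ∧ l ≠ j}) := by
      intro w hw
      induction hw using Submodule.span_induction with
      | mem w hw =>
        obtain ⟨p, q, hpq, hqk, rfl⟩ := hw
        rw [Pi.sub_apply]
        refine sub_mem ?_ ?_
        · rw [Pi.single_apply]
          split_ifs with hjp
          · exact Ideal.subset_span ⟨q, ⟨hqk, hjp ▸ hpq.ne'⟩, rfl⟩
          · exact zero_mem _
        · rw [Pi.single_apply]
          split_ifs with hjq
          · exact Ideal.subset_span ⟨p, ⟨hpq.trans hqk, hjq ▸ hpq.ne⟩, rfl⟩
          · exact zero_mem _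
      | zero => exact zero_mem _
      | add x y _ _ hx hy => exact add_mem hx hy
      | smul c x _ hx => exact Ideal.mul_mem_left _ c hx
    have hj := neg_mem (hcoord _ hspan)
    simp only [Pi.sub_apply, Pi.single_eq_same, Pi.single_eq_of_ne hij.ne', zero_sub, mul_neg,
      neg_neg, monomial_mul, one_mul] at hj
    obtain ⟨l, ⟨hlk, hlj⟩, hle⟩ := (monomial_mem_span_iff a _ _).mp hj
    exact ⟨l, hlk, hlj, hle⟩
  · intro hgcd r v hv hsum
    have hspan := syzygy_mem_span_pairs a r v hv hsum
    change (monomial (a r) 1 : MvPolynomial σ K) • v ∈ _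
    clear hv hsum
    induction hspan using Submodule.span_induction with
    | mem w hw =>
      obtain ⟨i, j, hij, hjr, rfl⟩ := hw
      have hle := hgcd r i j hij hjr
      have hi : a r + (a j - a i) = a r - a i ⊓ a j + a j := by
        ext t
        have : min (a i t) (a j t) ≤ a r t := hle t
        simp only [Finsupp.add_apply, Finsupp.tsub_apply, Finsupp.inf_apply]
        omega
      have hj : a r + (a i - a j) = a r - a i ⊓ a j + a i := by
        ext t
        have : min (a i t) (a j t) ≤ a r t := hle t
        simp only [Finsupp.add_apply, Finsupp.tsub_apply, Finsupp.inf_apply]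
        omega
      have heq : (monomial (a r) 1 : MvPolynomial σ K) •
            ((Pi.single i (monomial (a j - a i) 1) - Pi.single j (monomial (a i - a j) 1)) :
              Fin n → MvPolynomial σ K) =
          (monomial (a r - a i ⊓ a j) 1 : MvPolynomial σ K) •
            (Pi.single i (monomial (a j) 1) - Pi.single j (monomial (a i) 1)) := by
        simp only [smul_sub, ← Pi.single_smul, smul_eq_mul, monomial_mul, one_mul, hi, hj]
      rw [heq]
      exact Submodule.smul_mem _ _ (Submodule.subset_span ⟨i, j, hij, hjr, rfl⟩)
    | zero => rw [smul_zero]; exact zero_mem _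
    | add x y _ _ hx hy => rw [smul_add]; exact add_mem hx hy
    | smul c x _ hx => rw [smul_comm]; exact Submodule.smul_mem _ c hx

theorem colon_monomial_eq_iff {K σ : Type*} [Field K] {n : ℕ} (a : Fin n → σ →₀ ℕ)
    (hsq : ∀ i t, a i t ≤ 1) (hmin : ∀ i j, i ≠ j → ¬a i ≤ a j) :
    (∀ i k : Fin n, i ≤ k →
      (Ideal.span ((fun i => (monomial (a i) 1 : MvPolynomial σ K)) '' {j | j < i})).colon
          (Ideal.span {(monomial (a i) 1 : MvPolynomial σ K) * monomial (a k) 1}) =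
        (Ideal.span ((fun i => (monomial (a i) 1 : MvPolynomial σ K)) '' {j | j < i})).colon
          (Ideal.span {(monomial (a k) 1 : MvPolynomial σ K)})) ↔
      ∀ k i j, i < j → j < k → a i ⊓ a j ≤ a k := by
  simp only [Ideal.ext_iff, Ideal.mem_colon_span_singleton, monomial_mul, one_mul]
  constructor
  · intro hcolon
    refine inf_le_of_exists_le_add_tsub a hsq hmin fun i j k hij hjk => ?_
    have h := (hcolon j k hjk.le (monomial (a i - a j) 1)).mp (by
      rw [monomial_mul, one_mul, monomial_mem_span_iff]
      refine ⟨i, hij, fun t => ?_⟩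
      simp only [Finsupp.add_apply, Finsupp.tsub_apply]
      omega)
    rw [monomial_mul, one_mul, monomial_mem_span_iff, add_comm] at h
    obtain ⟨l, hlj, hle⟩ := h
    exact ⟨l, hlj.trans hjk, hlj.ne, hle⟩
  · intro hgcd i k hik x
    simp only [mul_monomial_mem_span_iff]
    refine forall₂_congr fun c _ => exists_congr fun l => and_congr_right fun hli => ?_
    refine forall_congr' fun t => ?_
    have hlt := hsq l t
    simp only [Finsupp.add_apply]
    rcases hik.lt_or_eq with hlt' | rfl
    · have : min (a l t) (a i t) ≤ a k t := hgcd k l i hli hlt' t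
      omega
    · omega

/-- For squarefree monomials (exponent vectors with entries ≤ 1) one always
has `gcd(f,g) = gcd(f,g²)`; consequently a squarefree minimal monomial
sequence is a proper sequence iff it is a d-sequence. -/
theorem stmt_11 {K : Type*} [Field K] {m n : ℕ} (a : Fin n → (Fin m →₀ ℕ))
    (f : Fin n → MvPolynomial (Fin m) K) (hf : ∀ i, f i = monomial (a i) 1)
    (hsq : ∀ i t, a i t ≤ 1)
    (hmin : ∀ i j : Fin n, i ≠ j → ¬f i ∣ f j) :
    (∀ p q : Fin m →₀ ℕ, (∀ t, p t ≤ 1) → (∀ t, q t ≤ 1) → p ⊓ q = p ⊓ (q + q)) ∧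
      (IsProperSequence f ↔ IsDSequence f) := by
  obtain rfl : f = fun i => monomial (a i) 1 := funext hf
  refine ⟨fun p q hp hq => ?_, ?_⟩
  · ext t
    have := hp t
    simp only [Finsupp.inf_apply, Finsupp.add_apply]
    omega
  · have hmin' : ∀ i j, i ≠ j → ¬a i ≤ a j := fun i j hij hle =>
      hmin i j hij (monomial_dvd_monomial.mpr ⟨Or.inr hle, one_dvd _⟩)
    rw [isProperSequence_monomial_iff a hsq hmin', IsDSequence,
      colon_monomial_eq_iff a hsq hmin', and_iff_right hmin]
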